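/- Let k ≥ 1 be odd and h ∈ ℤ with 0 ≤ h < k and gcd(h,k) = 1. Then lim_{t→0⁺} [ B(q(t)) − 2 e^{−πiτ(t)} η(4τ(t))⁵/η(2τ(t))⁴ ] = −(1/2) ∑_{n=0}^{(k−1)/2} ζ_k^{2hn} (ζ_k^h;ζ_k^{2h})_n² / (−ζ_k^{2h};ζ_k^{2h})_n. -/

import Mathlib

open scoped BigOperators Classical
open Filter Topology

noncomputable section

/-- finite q-Pochhammer symbol $(x;q)_n$ -/
def qPoch (x q : ℂ) (n : ℕ) : ℂ := ∏ j ∈ Finset.range n, (1 - x * q ^ j)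

/-- infinite q-Pochhammer symbol $(x;q)_\infty$ -/
def qPochInf (x q : ℂ) : ℂ := ∏' j : ℕ, (1 - x * q ^ j)

/-- $e(x) = e^{2\pi i x}$ -/
def ee (x : ℂ) : ℂ := Complex.exp (2 * Real.pi * Complex.I * x)

/-- $\zeta_n^m = e(m/n)$ -/
def zeta (m : ℤ) (n : ℕ) : ℂ := ee ((m : ℂ) / (n : ℂ))

/-- Dedekind eta -/
def eta (τ : ℂ) : ℂ := Complex.exp (Real.pi * Complex.I * τ / 12) * qPochInf (ee τ) (ee τ)

/-- Jacobi theta -/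
def theta (z τ : ℂ) : ℂ :=
  -Complex.I * Complex.exp (Real.pi * Complex.I * τ / 4) * Complex.exp (-(Real.pi * Complex.I * z))
    * qPochInf (ee τ) (ee τ) * qPochInf (ee z) (ee τ) * qPochInf ((ee z)⁻¹ * ee τ) (ee τ)

/-- universal mock theta function g₂ -/
def g2 (ζ q : ℂ) : ℂ :=
  ∑' n : ℕ, qPoch (-q) q n * q ^ (n * (n + 1) / 2) /
    (qPoch ζ q (n + 1) * qPoch (ζ⁻¹ * q) q (n + 1))

/-- universal mock theta function g₃ -/
def g3 (ζ q : ℂ) : ℂ :=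
  ∑' n : ℕ, q ^ (n * (n + 1)) / (qPoch ζ q (n + 1) * qPoch (ζ⁻¹ * q) q (n + 1))

/-- the series L -/
def Lser (ζ q : ℂ) : ℂ :=
  (1 / 2) * ∑' n : ℕ, q ^ n * qPoch (ζ⁻¹ * q) q n * qPoch ζ q n / qPoch (-q) q n

/-- the function M -/
def Mfun (z τ : ℂ) : ℂ :=
  -(Complex.I / 2) * Complex.exp (Real.pi * Complex.I * z) * theta z τ *
    g3 (-(ee z)) (ee τ) / (Complex.exp (Real.pi * Complex.I * τ / 12) * eta (2 * τ))

/-- the function T -/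
def Tfun (z τ : ℂ) : ℂ :=
  -Complex.I * eta (2 * τ) ^ 4 / (ee z * eta τ ^ 2 * theta (2 * z) (2 * τ))
  - Complex.I * eta (2 * τ) ^ 10 * theta (2 * z + 1 / 2) (2 * τ) /
      (2 * ee z ^ 2 * Complex.exp (Real.pi * Complex.I * τ / 2) * eta τ ^ 4 * eta (4 * τ) ^ 4 *
        theta (2 * z) (2 * τ) * theta (2 * z + τ + 1 / 2) (2 * τ))
  - Complex.I * eta (2 * τ) ^ 4 * theta z τ /
      (2 * Complex.exp (Real.pi * Complex.I * τ / 2) * ee z ^ 2 * eta (4 * τ) ^ 2 *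
        theta (z + 1 / 2) τ * theta (2 * z + τ + 1 / 2) (2 * τ))

/-- the function K -/
def Kfun (z τ : ℂ) : ℂ :=
  eta (2 * τ) ^ 4 / (Complex.I * ee z * eta τ ^ 2 * theta (2 * z) (2 * τ))

/-- Zwegers' μ-function -/
def mu (z₁ z₂ τ : ℂ) : ℂ :=
  Complex.exp (Real.pi * Complex.I * z₁) / theta z₂ τ *
    ∑' n : ℤ, (-(ee z₂)) ^ n * Complex.exp (Real.pi * Complex.I * (n : ℂ) * ((n : ℂ) + 1) * τ) /
      (1 - ee z₁ * (ee τ) ^ n)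

/-- the Appell–Lerch sum A -/
def appell (ζ q : ℂ) : ℂ :=
  ∑' n : ℤ, (-1 : ℂ) ^ n * q ^ ((3 * n * (n + 1)) / 2) / (1 + ζ * q ^ n)

/-- the function Θ -/
def bigTheta (z₁ z₂ z τ : ℂ) : ℂ :=
  (1 / (2 * Real.pi * Complex.I)) * deriv (fun w => theta w τ) 0 *
    theta (z₁ + z₂ + z) τ * theta z τ /
    (theta z₁ τ * theta z₂ τ * theta (z₁ + z) τ * theta (z₂ + z) τ)

/-- the function 𝔱 -/
def tfrak (z τ : ℂ) : ℂ :=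
  Kfun z τ - Complex.I * Kfun (z + 1 / 4) (τ + 1 / 2) +
    Complex.I * Complex.exp (-(Real.pi * Complex.I * τ / 2)) * bigTheta (2 * z) τ (1 / 2) (2 * τ)

/-- the second order mock theta function B -/
def mockB (q : ℂ) : ℂ :=
  ∑' n : ℕ, q ^ n * qPoch (-q) (q ^ 2) n / qPoch q (q ^ 2) (n + 1)

/-- Ramanujan's third order mock theta function f -/
def mockf (q : ℂ) : ℂ := ∑' n : ℕ, q ^ (n ^ 2) / qPoch (-q) q n ^ 2

/-- the modular form b -/
def bfun (q : ℂ) : ℂ := qPochInf q q / qPochInf (-q) q ^ 2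

/-- τ(t) = h/k + it/(2π) -/
def tauT (h k : ℕ) (t : ℝ) : ℂ := (h : ℂ) / (k : ℂ) + Complex.I * (t : ℂ) / (2 * Real.pi)

/-- q(t) = e^{2πiτ(t)} -/
def qT (h k : ℕ) (t : ℝ) : ℂ := ee (tauT h k t)

lemma qPoch_zero (x q : ℂ) : qPoch x q 0 = 1 := by simp [qPoch]

lemma qPoch_succ (x q : ℂ) (n : ℕ) : qPoch x q (n + 1) = qPoch x q n * (1 - x * q ^ n) :=
  Finset.prod_range_succ _ _

lemma qPoch_add (x q : ℂ) (m n : ℕ) :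
    qPoch x q (m + n) = qPoch x q m * qPoch (x * q ^ m) q n := by
  simp only [qPoch, Finset.prod_range_add, pow_add, mul_assoc]

lemma qPoch_succ' (x q : ℂ) (n : ℕ) : qPoch x q (n + 1) = (1 - x) * qPoch (x * q) q n := by
  rw [add_comm, qPoch_add]
  simp [qPoch]

lemma qPoch_ne_zero {x q : ℂ} (h : ∀ n, 1 - x * q ^ n ≠ 0) (n : ℕ) : qPoch x q n ≠ 0 :=
  Finset.prod_ne_zero_iff.mpr fun i _ => h i

lemma summable_norm_mul_pow {p : ℂ} (hp : ‖p‖ < 1) (x : ℂ) :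
    Summable fun n : ℕ => ‖-(x * p ^ n)‖ := by
  simpa using (summable_geometric_of_lt_one (norm_nonneg p) hp).mul_left ‖x‖

lemma multipliable_one_sub_mul_pow {p : ℂ} (hp : ‖p‖ < 1) (x : ℂ) :
    Multipliable fun n : ℕ => 1 - x * p ^ n := by
  simpa [sub_eq_add_neg] using multipliable_one_add_of_summable (summable_norm_mul_pow hp x)

lemma tendsto_qPoch {p : ℂ} (hp : ‖p‖ < 1) (x : ℂ) :
    Tendsto (qPoch x p) atTop (𝓝 (qPochInf x p)) :=
  (multipliable_one_sub_mul_pow hp x).tendsto_prod_tprod_nat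

lemma qPochInf_ne_zero {x p : ℂ} (hp : ‖p‖ < 1) (h : ∀ n, 1 - x * p ^ n ≠ 0) :
    qPochInf x p ≠ 0 := by
  have := tprod_one_add_ne_zero_of_summable (f := fun n : ℕ => -(x * p ^ n))
    (by simpa [sub_eq_add_neg] using h) (summable_norm_mul_pow hp x)
  simpa [qPochInf, sub_eq_add_neg] using this

lemma qPochInf_eq_one_sub_mul {p : ℂ} (hp : ‖p‖ < 1) (x : ℂ) :
    qPochInf x p = (1 - x) * qPochInf (x * p) p := by
  refine tendsto_nhds_unique ((tendsto_qPoch hp x).comp (tendsto_add_atTop_nat 1)) ?_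
  simpa only [Function.comp_def, qPoch_succ'] using (tendsto_qPoch hp (x * p)).const_mul (1 - x)

/-- Quotients of `q`-Pochhammer symbols to a common base are uniformly bounded. -/
lemma exists_norm_qPoch_div_le {p : ℂ} (hp : ‖p‖ < 1) (x : ℂ) {y : ℂ}
    (hy : ∀ n, 1 - y * p ^ n ≠ 0) :
    ∃ C, 0 ≤ C ∧ ∀ n, ‖qPoch x p n / qPoch y p n‖ ≤ C := by
  have h := (tendsto_qPoch hp x).div (tendsto_qPoch hp y) (qPochInf_ne_zero hp hy)
  obtain ⟨C, hC⟩ := (Metric.isBounded_range_of_tendsto _ h).exists_norm_le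
  have hC' : ∀ n, ‖qPoch x p n / qPoch y p n‖ ≤ C := fun n => hC _ ⟨n, rfl⟩
  exact ⟨C, (norm_nonneg _).trans (hC' 0), hC'⟩

lemma one_sub_ne_zero_of_norm_lt_one {x : ℂ} (hx : ‖x‖ < 1) : 1 - x ≠ 0 := by
  intro h
  rw [sub_eq_zero] at h
  simp [← h] at hx

lemma norm_mul_pow_lt_one {x p : ℂ} (hx : ‖x‖ < 1) (hp : ‖p‖ < 1) (n : ℕ) :
    ‖x * p ^ n‖ < 1 := by
  rw [norm_mul, norm_pow]
  exact (mul_le_of_le_one_right (norm_nonneg _) (pow_le_one₀ (norm_nonneg _) hp.le)).trans_lt hx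

lemma one_sub_mul_pow_ne_zero {x p : ℂ} (hx : ‖x‖ < 1) (hp : ‖p‖ < 1) (n : ℕ) :
    1 - x * p ^ n ≠ 0 :=
  one_sub_ne_zero_of_norm_lt_one (norm_mul_pow_lt_one hx hp n)

lemma summable_qPoch_div_mul_pow {p z : ℂ} (hp : ‖p‖ < 1) (hz : ‖z‖ < 1) (x : ℂ) {y : ℂ}
    (hy : ∀ n, 1 - y * p ^ n ≠ 0) :
    Summable fun n => qPoch x p n / qPoch y p n * z ^ n := by
  obtain ⟨C, -, hC⟩ := exists_norm_qPoch_div_le hp x hy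
  refine .of_norm_bounded ((summable_geometric_of_lt_one (norm_nonneg z) hz).mul_left C) fun n => ?_
  rw [norm_mul, norm_pow]
  gcongr
  exact hC n

/-- The basic hypergeometric series `₂φ₁(a, p; c; p, z)`. -/
def heine (a c p z : ℂ) : ℂ := ∑' n : ℕ, qPoch a p n / qPoch c p n * z ^ n

/-- Contiguous relation in the numerator parameter. -/
lemma heine_contiguous {p z : ℂ} (hp : ‖p‖ < 1) (hz : ‖z‖ < 1) (a : ℂ) {c : ℂ}
    (hc : ∀ n, 1 - c * p ^ n ≠ 0) :
    (p * a - c) * heine a c p z + (1 - a) * (c - z * p * a) * heine (a * p) c p z =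
      a * (p - c) := by
  set u : ℕ → ℂ := fun n => qPoch a p n / qPoch c p n * z ^ n with hu
  set v : ℕ → ℂ := fun n => qPoch (a * p) p n / qPoch c p n * z ^ n with hv
  have hus : Summable u := summable_qPoch_div_mul_pow hp hz a hc
  have hvs : Summable v := summable_qPoch_div_mul_pow hp hz (a * p) hc
  have hzp : ‖z * p‖ < 1 := by simpa using norm_mul_pow_lt_one hz hp 1
  have hVs : Summable fun n => u n * (p - c * p ^ n) := by
    have h := (hus.mul_left p).sub ((summable_qPoch_div_mul_pow hp hzp a hc).mul_left c)
    refine h.congr fun n => ?_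
    simp only [hu, mul_pow]
    ring
  have hva (n : ℕ) : (1 - a) * v n = u n * (1 - a * p ^ n) := by
    have : (1 - a) * qPoch (a * p) p n = qPoch a p n * (1 - a * p ^ n) := by
      rw [← qPoch_succ', qPoch_succ]
    simp only [hu, hv]
    linear_combination z ^ n / qPoch c p n * this
  have hu1 (n : ℕ) : u (n + 1) * (1 - c * p ^ n) = u n * (z * (1 - a * p ^ n)) := by
    have h0 := qPoch_ne_zero hc n
    have h1 := hc n
    simp only [hu, qPoch_succ]
    generalize 1 - c * p ^ n = d at h1 ⊢
    field_simp
    ring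
  have key (n : ℕ) : (p * a - c) * u n + (c - z * p * a) * ((1 - a) * v n) =
      a * (u n * (p - c * p ^ n) - u (n + 1) * (p - c * p ^ (n + 1))) := by
    rw [hva]
    linear_combination (a * p) * hu1 n
  have hsum := (hus.mul_left (p * a - c)).tsum_add ((hvs.mul_left (1 - a)).mul_left (c - z * p * a))
  simp only [key, tsum_mul_left] at hsum
  rw [hVs.tsum_sub ((summable_nat_add_iff 1).mpr hVs), hVs.tsum_eq_zero_add] at hsum
  have h0 : u 0 = 1 := by simp [hu, qPoch_zero]
  simp only [heine]
  rw [h0] at hsum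
  linear_combination -hsum

/-- The `q`-binomial theorem. -/
lemma tsum_qPoch_div_mul_pow {p z : ℂ} (hp : ‖p‖ < 1) (hz : ‖z‖ < 1) (a : ℂ) :
    ∑' n : ℕ, qPoch a p n / qPoch p p n * z ^ n = qPochInf (a * z) p / qPochInf z p := by
  set E : ℂ → ℂ := fun w => ∑' n : ℕ, qPoch a p n / qPoch p p n * w ^ n with hE
  have hpp := one_sub_mul_pow_ne_zero hp hp
  have hfun {w : ℂ} (hw : ‖w‖ < 1) : (1 - w) * E w = (1 - a * w) * E (w * p) := by
    have hwp : ‖w * p‖ < 1 := by simpa using norm_mul_pow_lt_one hw hp 1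
    have s1 := summable_qPoch_div_mul_pow hp hw a hpp
    have s2 := summable_qPoch_div_mul_pow hp hwp a hpp
    have key (n : ℕ) : qPoch a p (n + 1) / qPoch p p (n + 1) * w ^ (n + 1) -
        qPoch a p (n + 1) / qPoch p p (n + 1) * (w * p) ^ (n + 1) =
        w * (qPoch a p n / qPoch p p n * w ^ n) -
          a * w * (qPoch a p n / qPoch p p n * (w * p) ^ n) := by
      have h0 := qPoch_ne_zero hpp n
      have h1 := hpp n
      simp only [qPoch_succ]
      generalize hd : 1 - p * p ^ n = d at h1 ⊢
      field_simp
      rw [← hd]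
      ring
    have hs := s1.tsum_sub s2
    rw [(s1.sub s2).tsum_eq_zero_add] at hs
    simp only [key, pow_zero, sub_self, zero_add] at hs
    rw [(s1.mul_left w).tsum_sub (s2.mul_left (a * w)), tsum_mul_left, tsum_mul_left] at hs
    linear_combination -hs
  have hiter (n : ℕ) : qPoch z p n * E z = qPoch (a * z) p n * E (z * p ^ n) := by
    induction n with
    | zero => simp [qPoch_zero]
    | succ n ih =>
      have := hfun (norm_mul_pow_lt_one hz hp n)
      rw [qPoch_succ, qPoch_succ, pow_succ, ← mul_assoc z]
      linear_combination (1 - z * p ^ n) * ih + qPoch (a * z) p n * this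
  have hlim : Tendsto (fun n => E (z * p ^ n)) atTop (𝓝 1) := by
    obtain ⟨C, hC0, hC⟩ := exists_norm_qPoch_div_le hp a hpp
    have h0 : ∑' n : ℕ, qPoch a p n / qPoch p p n * (0 : ℂ) ^ n = 1 := by
      rw [tsum_eq_single 0 fun n hn => by simp [hn]]
      simp [qPoch_zero]
    rw [← h0]
    refine tendsto_tsum_of_dominated_convergence
      ((summable_geometric_of_lt_one (norm_nonneg z) hz).mul_left C) (fun n => ?_)
      (.of_forall fun m n => ?_)
    · have := (tendsto_pow_atTop_nhds_zero_of_norm_lt_one hp).const_mul z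
      rw [mul_zero] at this
      exact (this.pow n).const_mul _
    · rw [norm_mul, norm_pow]
      gcongr
      · exact hC n
      · rw [norm_mul, norm_pow]
        exact mul_le_of_le_one_right (norm_nonneg _) (pow_le_one₀ (norm_nonneg _) hp.le)
  have h := tendsto_nhds_unique ((tendsto_qPoch hp z).mul_const (E z))
    (((tendsto_qPoch hp (a * z)).mul hlim).congr fun n => (hiter n).symm)
  rw [eq_div_iff (qPochInf_ne_zero hp (one_sub_mul_pow_ne_zero hz hp))]
  linear_combination h

lemma norm_sq_lt_one {q : ℂ} (hq : ‖q‖ < 1) : ‖q ^ 2‖ < 1 := by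
  simpa [sq] using norm_mul_pow_lt_one hq hq 1

/-- For `n ≥ 0`, the coefficient of index `-n` in the bilateral series
`∑ (-q; q²)ₙ / (βq²; q²)ₙ qⁿ`. -/
def negTerm (q β : ℂ) (n : ℕ) : ℂ :=
  ∏ j ∈ Finset.range n, (q ^ (2 * j) - β) / (1 + q ^ (2 * j + 1))

lemma negTerm_zero (q β : ℂ) : negTerm q β 0 = 1 := Finset.prod_range_zero _

lemma negTerm_succ (q β : ℂ) (n : ℕ) :
    negTerm q β (n + 1) = negTerm q β n * ((q ^ (2 * n) - β) / (1 + q ^ (2 * n + 1))) :=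
  Finset.prod_range_succ _ _

lemma one_add_pow_odd_ne_zero {q : ℂ} (hq : ‖q‖ < 1) (n : ℕ) : 1 + q ^ (2 * n + 1) ≠ 0 := by
  have := one_sub_mul_pow_ne_zero (x := -q) (p := q) (by simpa using hq) hq (2 * n)
  rwa [neg_mul, sub_neg_eq_add, ← pow_succ'] at this

lemma negTerm_mul_sq {q : ℂ} (hq : ‖q‖ < 1) (β : ℂ) (n : ℕ) :
    negTerm q (β * q ^ 2) (n + 1) * (1 + q ^ (2 * n + 1)) =
      (1 - β * q ^ 2) * q ^ (2 * n) * negTerm q β n := by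
  induction n with
  | zero =>
    have := one_add_pow_odd_ne_zero hq 0
    simp only [negTerm, Finset.prod_range_succ, Finset.prod_range_zero] at this ⊢
    field_simp
    simp
  | succ n ih =>
    rw [negTerm_succ q _ (n + 1), negTerm_succ q β n]
    have h1 := one_add_pow_odd_ne_zero hq n
    have h2 := one_add_pow_odd_ne_zero hq (n + 1)
    rw [mul_assoc, div_mul_cancel₀ _ h2, eq_div_of_mul_eq h1 ih]
    ring

/-- A summable majorant of `negTerm q β` for `‖β‖ ≤ ‖q‖`. -/
def negBound (q : ℂ) (n : ℕ) : ℝ :=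
  ∏ j ∈ Finset.range n, (‖q‖ ^ (2 * j) + ‖q‖) / ‖1 + q ^ (2 * j + 1)‖

lemma summable_negBound {q : ℂ} (hq : ‖q‖ < 1) : Summable (negBound q) := by
  obtain ⟨r, hr, hr1⟩ := exists_between hq
  refine summable_of_ratio_norm_eventually_le hr1 ?_
  have h1 : Tendsto (fun n : ℕ => (‖q‖ ^ (2 * n) + ‖q‖) / ‖1 + q ^ (2 * n + 1)‖) atTop
      (𝓝 ((0 + ‖q‖) / ‖(1 : ℂ) + 0‖)) := by
    have e : Tendsto (fun n : ℕ => 2 * n) atTop atTop :=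
      tendsto_id.const_mul_atTop' two_pos
    refine .div (((tendsto_pow_atTop_nhds_zero_of_lt_one (norm_nonneg q) hq).comp e).add_const _)
      (Tendsto.norm (.const_add _ ?_)) (by simp)
    exact (tendsto_pow_atTop_nhds_zero_of_norm_lt_one hq).comp
      ((tendsto_add_atTop_nat 1).comp e)
  filter_upwards [h1.eventually_le_const (by simpa using hr)] with n hn
  rw [negBound, Finset.prod_range_succ, ← negBound, norm_mul, mul_comm]
  gcongr
  rwa [Real.norm_of_nonneg (by positivity)]

lemma norm_negTerm_le {q β : ℂ} (hβ : ‖β‖ ≤ ‖q‖) (n : ℕ) : ‖negTerm q β n‖ ≤ negBound q n := by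
  rw [negTerm, norm_prod]
  refine Finset.prod_le_prod (fun _ _ => norm_nonneg _) fun j _ => ?_
  rw [norm_div]
  gcongr
  refine (norm_sub_le _ _).trans ?_
  rw [norm_pow]
  gcongr

lemma summable_negTerm {q β : ℂ} (hq : ‖q‖ < 1) (hβ : ‖β‖ ≤ ‖q‖) : Summable (negTerm q β) :=
  .of_norm_bounded (summable_negBound hq) (norm_negTerm_le hβ)

lemma negTerm_one_succ (q : ℂ) (n : ℕ) : negTerm q 1 (n + 1) = 0 :=
  Finset.prod_eq_zero (i := 0) (by simp) (by simp)

lemma summable_negTerm_one (q : ℂ) : Summable (negTerm q 1) :=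
  (summable_nat_add_iff 1).mp (by simp [negTerm_one_succ])

lemma norm_mul_sq_le {q β : ℂ} (hq : ‖q‖ < 1) (hβ : ‖β‖ ≤ 1) : ‖β * q ^ 2‖ ≤ ‖q‖ := by
  rw [norm_mul, norm_pow]
  nlinarith [norm_nonneg q, norm_nonneg β, mul_nonneg (norm_nonneg q) (norm_nonneg q)]

/-- The bilateral series `∑ (-q; q²)ₙ / (βq²; q²)ₙ qⁿ`, the sum running over all integers. -/
def bilateral (q β : ℂ) : ℂ := heine (-q) (β * q ^ 2) (q ^ 2) q + ∑' n, negTerm q β n - 1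

lemma one_sub_mul_sq_pow_ne_zero {q β : ℂ} (hq : ‖q‖ < 1) (hβ : ‖β‖ ≤ 1) (n : ℕ) :
    1 - β * q ^ 2 * (q ^ 2) ^ n ≠ 0 :=
  one_sub_mul_pow_ne_zero ((norm_mul_sq_le hq hβ).trans_lt hq) (norm_sq_lt_one hq) n

lemma bilateral_mul_sq {q β : ℂ} (hq : ‖q‖ < 1) (hβ : ‖β‖ ≤ 1) (hs : Summable (negTerm q β)) :
    (1 + β) * (1 - β * q ^ 2) * bilateral q β = (1 + q * β) * bilateral q (β * q ^ 2) := by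
  have hq2 := norm_sq_lt_one hq
  have hβq := norm_mul_sq_le hq hβ
  have hne := one_sub_mul_sq_pow_ne_zero hq hβ
  have hne' := one_sub_mul_sq_pow_ne_zero hq (hβq.trans hq.le)
  have hb : 1 - β * q ^ 2 ≠ 0 := by simpa using hne 0
  have s1 := summable_qPoch_div_mul_pow hq2 hq (-q) hne
  have s2 := summable_qPoch_div_mul_pow hq2 hq (-q) hne'
  have hpos : (1 + β) * heine (-q) (β * q ^ 2) (q ^ 2) q - β =
      (1 + q * β) / (1 - β * q ^ 2) * heine (-q) (β * q ^ 2 * q ^ 2) (q ^ 2) q := by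
    have key (n : ℕ) : qPoch (-q) (q ^ 2) n / qPoch (β * q ^ 2) (q ^ 2) n * q ^ n +
        β * (qPoch (-q) (q ^ 2) (n + 1) / qPoch (β * q ^ 2) (q ^ 2) (n + 1) * q ^ (n + 1)) =
        (1 + q * β) / (1 - β * q ^ 2) *
          (qPoch (-q) (q ^ 2) n / qPoch (β * q ^ 2 * q ^ 2) (q ^ 2) n * q ^ n) := by
      have e : qPoch (β * q ^ 2 * q ^ 2) (q ^ 2) n =
          qPoch (β * q ^ 2) (q ^ 2) n * (1 - β * q ^ 2 * (q ^ 2) ^ n) / (1 - β * q ^ 2) := by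
        rw [eq_div_iff hb, mul_comm, ← qPoch_succ', qPoch_succ]
      have h0 := qPoch_ne_zero hne n
      have h1 := hne n
      rw [e]
      simp only [qPoch_succ]
      generalize hd : 1 - β * q ^ 2 * (q ^ 2) ^ n = d at h1 ⊢
      generalize 1 - β * q ^ 2 = b at hb ⊢
      field_simp
      rw [← hd]
      ring
    have h := s1.tsum_add (((summable_nat_add_iff 1).mpr s1).mul_left β)
    simp only [key, tsum_mul_left] at h
    have h' := s1.tsum_eq_zero_add
    simp only [qPoch_zero, pow_zero, div_one, mul_one] at h'
    simp only [heine]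
    rw [h]
    linear_combination β * h'
  have hneg : (1 + β) * ∑' n, negTerm q β n - 1 =
      (1 + q * β) / (1 - β * q ^ 2) * (∑' n, negTerm q (β * q ^ 2) n - 1) := by
    have key (n : ℕ) : negTerm q β (n + 1) + β * negTerm q β n =
        (1 + q * β) / (1 - β * q ^ 2) * negTerm q (β * q ^ 2) (n + 1) := by
      have h1 := one_add_pow_odd_ne_zero hq n
      rw [eq_div_of_mul_eq h1 (negTerm_mul_sq hq β n), negTerm_succ]
      generalize hd : 1 + q ^ (2 * n + 1) = d at h1 ⊢
      generalize 1 - β * q ^ 2 = b at hb ⊢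
      field_simp
      rw [← hd]
      ring
    have h := ((summable_nat_add_iff 1).mpr hs).tsum_add (hs.mul_left β)
    simp only [key, tsum_mul_left] at h
    have h' := hs.tsum_eq_zero_add
    have h'' := (summable_negTerm hq hβq).tsum_eq_zero_add
    rw [negTerm_zero] at h' h''
    rw [h'', add_sub_cancel_left, h]
    linear_combination h'
  simp only [bilateral]
  have e : (1 + q * β) / (1 - β * q ^ 2) * (1 - β * q ^ 2) = 1 + q * β := div_mul_cancel₀ _ hb
  linear_combination (1 - β * q ^ 2) * (hpos + hneg) + (heine (-q) (β * q ^ 2 * q ^ 2) (q ^ 2) q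
    + ∑' n, negTerm q (β * q ^ 2) n - 1) * e

lemma bilateral_mul_pow {q β : ℂ} (hq : ‖q‖ < 1) (hβ : ‖β‖ ≤ 1) (hs : Summable (negTerm q β))
    (n : ℕ) : qPoch (-β) (q ^ 2) n * qPoch (β * q ^ 2) (q ^ 2) n * bilateral q β =
      qPoch (-(q * β)) (q ^ 2) n * bilateral q (β * (q ^ 2) ^ n) := by
  have hsn (n : ℕ) : Summable (negTerm q (β * (q ^ 2) ^ n)) ∧ ‖β * (q ^ 2) ^ n‖ ≤ 1 := by
    induction n with
    | zero => simpa using ⟨hs, hβ⟩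
    | succ n ih =>
      have := norm_mul_sq_le hq ih.2
      rw [pow_succ, ← mul_assoc]
      exact ⟨summable_negTerm hq this, this.trans hq.le⟩
  induction n with
  | zero => simp [qPoch_zero]
  | succ n ih =>
    have := bilateral_mul_sq hq (hsn n).2 (hsn n).1
    simp only [qPoch_succ]
    rw [pow_succ (q ^ 2) n, ← mul_assoc β]
    linear_combination (1 + β * (q ^ 2) ^ n) * (1 - β * q ^ 2 * (q ^ 2) ^ n) * ih +
      qPoch (-(q * β)) (q ^ 2) n * this

lemma tendsto_bilateral {q β : ℂ} (hq : ‖q‖ < 1) (hβ : ‖β‖ ≤ 1) :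
    Tendsto (fun n => bilateral q (β * (q ^ 2) ^ n)) atTop (𝓝 (bilateral q 0)) := by
  have hq2 := norm_sq_lt_one hq
  have hlim : Tendsto (fun n => β * (q ^ 2) ^ n) atTop (𝓝 0) := by
    simpa using (tendsto_pow_atTop_nhds_zero_of_norm_lt_one hq2).const_mul β
  have hne := one_sub_mul_sq_pow_ne_zero hq hβ
  refine .sub_const (.add ?_ ?_) 1
  · obtain ⟨C, hC0, hC⟩ := exists_norm_qPoch_div_le hq2 (-q) (y := 0) (by simp)
    obtain ⟨D, hD0, hD⟩ := exists_norm_qPoch_div_le hq2 0 hne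
    obtain ⟨K, hK0, hK⟩ := exists_norm_qPoch_div_le hq2 (β * q ^ 2) (y := 0) (by simp)
    have z (n : ℕ) : qPoch 0 (q ^ 2) n = 1 := by simp [qPoch]
    simp only [z, div_one, one_div] at hC hD hK
    refine tendsto_tsum_of_dominated_convergence
      ((summable_geometric_of_lt_one (norm_nonneg q) hq).mul_left (C * (K * D))) (fun n => ?_)
      (.of_forall fun m n => ?_)
    · refine .mul_const _ (.div tendsto_const_nhds ?_ (by simp [z]))
      exact tendsto_finsetProd _ fun j _ => .const_sub _ (.mul_const _ (hlim.mul_const _))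
    · rw [norm_mul, norm_pow, div_eq_mul_inv, norm_mul]
      gcongr
      · exact hC n
      · have e : (qPoch (β * (q ^ 2) ^ m * q ^ 2) (q ^ 2) n)⁻¹ =
            qPoch (β * q ^ 2) (q ^ 2) m * (qPoch (β * q ^ 2) (q ^ 2) (m + n))⁻¹ := by
          rw [qPoch_add, mul_inv, mul_inv_cancel_left₀ (qPoch_ne_zero hne m), mul_right_comm]
        rw [e, norm_mul]
        gcongr
        · exact hK m
        · exact hD _
  · refine tendsto_tsum_of_dominated_convergence (summable_negBound hq) (fun n => ?_) ?_
    · exact tendsto_finsetProd _ fun j _ => (hlim.const_sub _).div_const _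
    · filter_upwards [eventually_ge_atTop 1] with m hm n
      refine norm_negTerm_le ?_ n
      obtain ⟨m, rfl⟩ := Nat.exists_eq_add_of_le' hm
      rw [pow_succ, ← mul_assoc]
      exact norm_mul_sq_le hq ((norm_mul _ _).trans_le (mul_le_one₀ hβ (norm_nonneg _)
        ((norm_pow _ _).trans_le (pow_le_one₀ (norm_nonneg _) hq2.le))))

lemma bilateral_eq {q β : ℂ} (hq : ‖q‖ < 1) (hβ : ‖β‖ ≤ 1) (hs : Summable (negTerm q β)) :
    qPochInf (-β) (q ^ 2) * qPochInf (β * q ^ 2) (q ^ 2) * bilateral q β =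
      qPochInf (-(q * β)) (q ^ 2) * bilateral q 0 := by
  have hq2 := norm_sq_lt_one hq
  refine tendsto_nhds_unique
    (((tendsto_qPoch hq2 _).mul (tendsto_qPoch hq2 _)).mul_const _)
    (((tendsto_qPoch hq2 _).mul (tendsto_bilateral hq hβ)).congr fun n => ?_)
  exact (bilateral_mul_pow hq hβ hs n).symm

lemma heine_eq_mockB {q : ℂ} (hq : ‖q‖ < 1) :
    heine (-q) (q ^ 3) (q ^ 2) q = (1 - q) * mockB q := by
  simp only [mockB, heine, ← tsum_mul_left]
  refine tsum_congr fun n => ?_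
  rw [qPoch_succ', ← pow_succ', mul_div_assoc',
    mul_div_mul_left _ _ (one_sub_ne_zero_of_norm_lt_one hq)]
  ring

lemma negTerm_self (q : ℂ) (n : ℕ) : negTerm q q (n + 1) =
    (1 - q) * ((-q) ^ n * qPoch (- -q) ((-q) ^ 2) n / qPoch (-q) ((-q) ^ 2) (n + 1)) := by
  induction n with
  | zero => simp [negTerm, qPoch, div_eq_mul_inv]
  | succ n ih =>
    rw [negTerm_succ, ih, qPoch_succ _ _ (n + 1), qPoch_succ (- -q) _ n]
    have e : 1 - -q * ((-q) ^ 2) ^ (n + 1) = 1 + q ^ (2 * (n + 1) + 1) := by ring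
    rw [e, ← div_div, pow_succ (-q) n]
    ring

lemma bilateral_self {q : ℂ} (hq : ‖q‖ < 1) :
    bilateral q q = (1 - q) * (mockB q + mockB (-q)) := by
  rw [bilateral, (summable_negTerm hq le_rfl).tsum_eq_zero_add, ← pow_succ', heine_eq_mockB hq]
  simp only [negTerm_self, tsum_mul_left]
  rw [← mockB]
  simp [negTerm]
  ring

lemma bilateral_one {q : ℂ} (hq : ‖q‖ < 1) :
    bilateral q 1 = qPochInf (-q ^ 2) (q ^ 2) / qPochInf q (q ^ 2) := by
  rw [bilateral, (summable_negTerm_one q).tsum_eq_zero_add]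
  simp only [negTerm_one_succ, tsum_zero]
  rw [one_mul, heine, tsum_qPoch_div_mul_pow (norm_sq_lt_one hq) hq]
  simp [negTerm, sq]

lemma qPochInf_neg_mul {p : ℂ} (hp : ‖p‖ < 1) (x : ℂ) :
    qPochInf (-x) p * qPochInf x p = qPochInf (x ^ 2) (p ^ 2) := by
  refine tendsto_nhds_unique ((tendsto_qPoch hp _).mul (tendsto_qPoch hp _))
    ((tendsto_qPoch (norm_sq_lt_one hp) _).congr fun n => ?_)
  simp only [qPoch, ← Finset.prod_mul_distrib]
  exact Finset.prod_congr rfl fun j _ => by ring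

lemma qPochInf_sq_mul {p : ℂ} (hp : ‖p‖ < 1) :
    qPochInf p (p ^ 2) * qPochInf (p ^ 2) (p ^ 2) = qPochInf p p := by
  have hp2 := norm_sq_lt_one hp
  have e : Tendsto (fun n : ℕ => 2 * n) atTop atTop := tendsto_id.const_mul_atTop' two_pos
  refine tendsto_nhds_unique ((tendsto_qPoch hp2 _).mul (tendsto_qPoch hp2 _))
    (((tendsto_qPoch hp p).comp e).congr fun n => ?_)
  induction n with
  | zero => simp [qPoch]
  | succ n ih =>
    simp only [Function.comp_apply, mul_add, mul_one, qPoch_succ] at ih ⊢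
    rw [ih]
    ring

theorem mockB_add_mockB_neg {q : ℂ} (hq : ‖q‖ < 1) :
    mockB q + mockB (-q) = 2 * qPochInf (q ^ 4) (q ^ 4) ^ 5 / qPochInf (q ^ 2) (q ^ 2) ^ 4 := by
  have hq2 := norm_sq_lt_one hq
  have hnq : ‖-q‖ < 1 := by simpa using hq
  have hnq2 : ‖-q ^ 2‖ < 1 := by simpa using hq2
  have h1 := bilateral_eq hq hq.le (summable_negTerm hq le_rfl)
  have h2 := bilateral_eq hq (by simp) (summable_negTerm_one q)
  rw [bilateral_self hq, ← pow_succ', ← sq] at h1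
  rw [bilateral_one hq, one_mul, mul_one] at h2
  have h3 := qPochInf_eq_one_sub_mul hq2 q
  have h4 := qPochInf_eq_one_sub_mul hq2 (-1)
  have h5 := qPochInf_neg_mul hq2 (q ^ 2)
  have h6 := qPochInf_neg_mul hq2 q
  have h7 := qPochInf_sq_mul hq2
  rw [← pow_succ'] at h3
  rw [neg_one_mul] at h4
  simp only [← pow_mul, Nat.reduceMul, Nat.reduceAdd] at h1 h2 h3 h4 h5 h6 h7
  have n1 : qPochInf q (q ^ 2) ≠ 0 := qPochInf_ne_zero hq2 (one_sub_mul_pow_ne_zero hq hq2)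
  have n2 : qPochInf (-q) (q ^ 2) ≠ 0 := qPochInf_ne_zero hq2 (one_sub_mul_pow_ne_zero hnq hq2)
  have n3 : qPochInf (q ^ 2) (q ^ 2) ≠ 0 := qPochInf_ne_zero hq2 (one_sub_mul_pow_ne_zero hq2 hq2)
  have n4 : qPochInf (-q ^ 2) (q ^ 2) ≠ 0 :=
    qPochInf_ne_zero hq2 (one_sub_mul_pow_ne_zero hnq2 hq2)
  rw [h4] at h2
  generalize qPochInf (-q ^ 2) (q ^ 2) = E at *
  generalize qPochInf (-q) (q ^ 2) = O' at *
  generalize qPochInf (q ^ 2) (q ^ 2) = P2 at *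
  generalize qPochInf (q ^ 2) (q ^ 4) = O2 at *
  generalize qPochInf (q ^ 4) (q ^ 4) = P4 at *
  have h8 : O' ^ 2 * qPochInf q (q ^ 2) ^ 2 * (mockB q + mockB (-q)) = 2 * E ^ 3 * P2 := by
    rw [mul_div_assoc', div_eq_iff n1] at h2
    rw [h3] at h2 n1 ⊢
    have h9 : O' * qPochInf (q ^ 3) (q ^ 2) * ((1 - q) * (mockB q + mockB (-q))) * O' *
        ((1 - q) * qPochInf (q ^ 3) (q ^ 2)) = 2 * E ^ 3 * P2 := by
      rw [h1]
      linear_combination -E * h2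
    linear_combination h9
  generalize qPochInf q (q ^ 2) = O at *
  rw [eq_div_iff (pow_ne_zero 4 n3)]
  subst h5
  subst h6
  have n5 : O' ^ 2 * O ^ 2 ≠ 0 := by positivity
  apply mul_left_cancel₀ n5
  linear_combination P2 ^ 4 * h8 - 2 * E ^ 3 * P2 ^ 4 * (1 + O' * O * E) * h7

lemma one_add_mul_heine {q : ℂ} (hq : ‖q‖ < 1) (hq0 : q ≠ 0) (j : ℕ) :
    (1 + (q ^ 2) ^ j) * heine (q ^ (2 * j + 1)) (-q ^ 3) (q ^ 2) (-q) = (1 + q) * (q ^ 2) ^ j +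
      (1 - q * (q ^ 2) ^ j) ^ 2 * heine (q ^ (2 * (j + 1) + 1)) (-q ^ 3) (q ^ 2) (-q) := by
  have hq2 := norm_sq_lt_one hq
  have hc : ‖-q ^ 3‖ < 1 := by
    rw [norm_neg, norm_pow]
    exact pow_lt_one₀ (norm_nonneg _) hq (by norm_num)
  have h := heine_contiguous hq2 (z := -q) (by simpa using hq) (q ^ (2 * j + 1))
    (one_sub_mul_pow_ne_zero hc hq2)
  rw [show q ^ (2 * j + 1) * q ^ 2 = q ^ (2 * (j + 1) + 1) by ring] at h
  apply mul_left_cancel₀ (pow_ne_zero 3 hq0)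
  linear_combination h

/-- Expansion of `mockB (-q)` obtained by iterating the contiguous relation. -/
lemma mockB_neg_eq_sum_add {q : ℂ} (hq : ‖q‖ < 1) (hq0 : q ≠ 0) (J : ℕ) :
    mockB (-q) = 1 / 2 * ∑ n ∈ Finset.range J,
        (q ^ 2) ^ n * qPoch q (q ^ 2) n ^ 2 / qPoch (-q ^ 2) (q ^ 2) n +
      qPoch q (q ^ 2) J ^ 2 / qPoch (-q ^ 2) (q ^ 2) J * ((1 + (q ^ 2) ^ J) / (2 * (1 + q))) *
        heine (q ^ (2 * J + 1)) (-q ^ 3) (q ^ 2) (-q) := by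
  have hq2 := norm_sq_lt_one hq
  have h1 : 1 + q ≠ 0 := by simpa using one_add_pow_odd_ne_zero hq 0
  induction J with
  | zero =>
    have := heine_eq_mockB (q := -q) (by simpa using hq)
    rw [neg_neg, neg_sq, Odd.neg_pow (by decide), sub_neg_eq_add] at this
    simp only [Finset.range_zero, Finset.sum_empty, qPoch_zero, mul_zero, zero_add, pow_one, this]
    field_simp
    ring
  | succ J ih =>
    have hne := one_sub_mul_pow_ne_zero (x := -q ^ 2) (by simpa using hq2) hq2
    have h0 := qPoch_ne_zero hne J
    have h2 := hne J
    have h := one_add_mul_heine hq hq0 J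
    have e : 1 + (q ^ 2) ^ (J + 1) = 1 - -q ^ 2 * (q ^ 2) ^ J := by ring
    rw [ih, Finset.sum_range_succ, qPoch_succ, qPoch_succ, e]
    generalize 1 - -q ^ 2 * (q ^ 2) ^ J = d at h2 ⊢
    generalize heine (q ^ (2 * J + 1)) (-q ^ 3) (q ^ 2) (-q) = L at *
    generalize heine (q ^ (2 * (J + 1) + 1)) (-q ^ 3) (q ^ 2) (-q) = L' at *
    generalize (q ^ 2) ^ J = r at *
    generalize qPoch (-q ^ 2) (q ^ 2) J = D at *
    field_simp
    linear_combination qPoch q (q ^ 2) J ^ 2 * h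

lemma norm_prod_sub_prod_le {f g : ℕ → ℂ} {δ : ℝ} (hf : ∀ i, ‖f i‖ ≤ 2) (hg : ∀ i, ‖g i‖ ≤ 2)
    (n : ℕ) (h : ∀ i < n, ‖f i - g i‖ ≤ δ) :
    ‖∏ i ∈ Finset.range n, f i - ∏ i ∈ Finset.range n, g i‖ ≤ n * 2 ^ n * δ := by
  induction n with
  | zero => simp
  | succ n ih =>
    have ih := ih fun i hi => h i (hi.trans n.lt_succ_self)
    have hn := h n n.lt_succ_self
    have hδ : 0 ≤ δ := (norm_nonneg _).trans hn
    have hG : ‖∏ i ∈ Finset.range n, g i‖ ≤ 2 ^ n := by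
      rw [norm_prod]
      simpa using Finset.prod_le_prod (s := Finset.range n) (fun i _ => norm_nonneg (g i))
        fun i _ => hg i
    rw [Finset.prod_range_succ, Finset.prod_range_succ]
    calc _ = ‖(∏ i ∈ Finset.range n, f i - ∏ i ∈ Finset.range n, g i) * f n +
          (∏ i ∈ Finset.range n, g i) * (f n - g n)‖ := by ring_nf
      _ ≤ n * 2 ^ n * δ * 2 + 2 ^ n * δ := by
        refine (norm_add_le _ _).trans ?_
        rw [norm_mul, norm_mul]
        gcongr
        exact hf n
      _ ≤ _ := by
        push_cast
        rw [pow_succ]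
        nlinarith [mul_nonneg (pow_nonneg zero_le_two n : (0 : ℝ) ≤ 2 ^ n) hδ]

lemma exp_neg_two_mul_le {y : ℝ} (h0 : 0 ≤ y) (h1 : y ≤ 1 / 2) : Real.exp (-(2 * y)) ≤ 1 - y := by
  rw [Real.exp_neg, inv_le_iff_one_le_mul₀ (Real.exp_pos _)]
  nlinarith [Real.add_one_le_exp (2 * y)]

section RadialBound

variable {ζ : ℂ} {k : ℕ}

lemma qPoch_primitiveRoot (hζ : IsPrimitiveRoot ζ k) (hk : Odd k) (w : ℂ) (a : ℕ) :
    qPoch (w * ζ ^ a) (ζ ^ 2) k = 1 - w ^ k := by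
  have h2 : IsPrimitiveRoot (ζ ^ 2) k := hζ.pow_of_coprime 2 hk.coprime_two_left
  have h := congrArg (Polynomial.eval 1) (X_pow_sub_C_eq_prod h2 hk.pos (rfl : (w * ζ ^ a) ^ k = _))
  rw [mul_pow, ← pow_mul, mul_comm a, pow_mul, hζ.pow_eq_one] at h
  simp only [Polynomial.eval_sub, Polynomial.eval_pow, Polynomial.eval_X, Polynomial.eval_C,
    Polynomial.eval_prod, one_pow, mul_one] at h
  rw [h, qPoch]
  exact Finset.prod_congr rfl fun i _ => by ring

/-- The point `ζ e^{-t}` on the ray through `ζ`. -/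
def radial (ζ : ℂ) (t : ℝ) : ℂ := ζ * Real.exp (-t)

lemma norm_radial (hζ : ‖ζ‖ = 1) (t : ℝ) : ‖radial ζ t‖ = Real.exp (-t) := by
  rw [radial, norm_mul, hζ, Complex.norm_of_nonneg (Real.exp_pos _).le, one_mul]

lemma norm_radial_le (hζ : ‖ζ‖ = 1) {t : ℝ} (ht : 0 ≤ t) : ‖radial ζ t‖ ≤ 1 := by
  simpa [norm_radial hζ] using ht

lemma radial_pow (t : ℝ) (m : ℕ) : radial ζ t ^ m = ζ ^ m * Real.exp (-(m * t)) := by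
  rw [radial, mul_pow, ← Complex.ofReal_pow, ← Real.exp_nat_mul, mul_neg]

lemma norm_radial_pow_sub_le (hζ : ‖ζ‖ = 1) {t : ℝ} (ht : 0 ≤ t) (m : ℕ) :
    ‖radial ζ t ^ m - ζ ^ m‖ ≤ m * t := by
  have h : radial ζ t ^ m - ζ ^ m = ζ ^ m * ((Real.exp (-(m * t)) - 1 : ℝ) : ℂ) := by
    rw [radial_pow]
    push_cast
    ring
  rw [h, norm_mul, norm_pow, hζ, one_pow, one_mul, Complex.norm_real, Real.norm_eq_abs, abs_le]
  have := Real.one_sub_le_exp_neg (m * t)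
  have h1 : Real.exp (-(m * t)) ≤ 1 := by simpa using by positivity
  constructor <;> linarith [mul_nonneg m.cast_nonneg ht]

lemma norm_one_sub_le_two {x : ℂ} (hx : ‖x‖ ≤ 1) : ‖1 - x‖ ≤ 2 :=
  (norm_sub_le _ _).trans (by rw [norm_one]; linarith)

lemma norm_mul_pow_le_one {x q : ℂ} (hx : ‖x‖ ≤ 1) (hq : ‖q‖ ≤ 1) (n : ℕ) : ‖x * q ^ n‖ ≤ 1 := by
  rw [norm_mul, norm_pow]
  exact mul_le_one₀ hx (by positivity) (pow_le_one₀ (norm_nonneg _) hq)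

lemma norm_qPoch_le {x q : ℂ} (hx : ‖x‖ ≤ 1) (hq : ‖q‖ ≤ 1) (n : ℕ) : ‖qPoch x q n‖ ≤ 2 ^ n := by
  rw [qPoch, norm_prod]
  simpa using Finset.prod_le_prod (s := Finset.range n) (fun i _ => norm_nonneg (1 - x * q ^ i))
    fun i _ => norm_one_sub_le_two (norm_mul_pow_le_one hx hq i)

lemma norm_sq_le_one {q : ℂ} (hq : ‖q‖ ≤ 1) : ‖q ^ 2‖ ≤ 1 := by
  rw [norm_pow]
  exact pow_le_one₀ (norm_nonneg _) hq

lemma norm_qPoch_period_sub_le (hζ : IsPrimitiveRoot ζ k) (hk : Odd k) (a : ℕ) {t : ℝ}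
    (ht : 0 ≤ t) {w : ℂ} (hw : ‖w‖ ≤ 1) :
    ‖qPoch (w * radial ζ t ^ a) (radial ζ t ^ 2) k - (1 - w ^ k)‖ ≤
      k * 2 ^ k * (a + 2 * k) * (‖w‖ * t) := by
  have hn := hζ.norm'_eq_one hk.pos.ne'
  have hr := norm_radial_le hn ht
  rw [← qPoch_primitiveRoot hζ hk w a, mul_assoc (_ * _)]
  refine norm_prod_sub_prod_le
    (fun i => norm_one_sub_le_two (norm_mul_pow_le_one (norm_mul_pow_le_one hw hr a)
      (norm_sq_le_one hr) i))
    (fun i => norm_one_sub_le_two (norm_mul_pow_le_one (norm_mul_pow_le_one hw hn.le a)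
      (norm_sq_le_one hn.le) i)) k fun i hi => ?_
  have e : 1 - w * radial ζ t ^ a * (radial ζ t ^ 2) ^ i - (1 - w * ζ ^ a * (ζ ^ 2) ^ i) =
      -(w * (radial ζ t ^ (a + 2 * i) - ζ ^ (a + 2 * i))) := by ring
  rw [e, norm_neg, norm_mul]
  have h := norm_radial_pow_sub_le hn ht (a + 2 * i)
  push_cast at h
  have hi' : (i : ℝ) ≤ k := by exact_mod_cast hi.le
  calc _ ≤ ‖w‖ * ((a + 2 * i) * t) := by gcongr
    _ ≤ ‖w‖ * ((a + 2 * k) * t) := by gcongr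
    _ = _ := by ring

lemma radial_sq_pow_mul (hζ : IsPrimitiveRoot ζ k) (t : ℝ) (m : ℕ) :
    (radial ζ t ^ 2) ^ (k * m) = ((Real.exp (-(2 * k * t)) ^ m : ℝ) : ℂ) := by
  rw [← pow_mul, radial_pow, mul_left_comm, pow_mul, hζ.pow_eq_one, one_pow, one_mul,
    ← Real.exp_nat_mul]
  push_cast
  congr 2
  ring

lemma mul_geom_sum_le (hk : 0 < k) {t : ℝ} (ht : 0 ≤ t) (ht' : t ≤ 1 / 2) (M : ℕ) :
    t * ∑ m ∈ Finset.range M, Real.exp (-(2 * k * t)) ^ m ≤ 1 := by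
  have h1 : t ≤ 1 - Real.exp (-(2 * k * t)) := by
    have h := exp_neg_two_mul_le ht ht'
    have hk' : (1 : ℝ) ≤ k := by exact_mod_cast hk
    have : Real.exp (-(2 * k * t)) ≤ Real.exp (-(2 * t)) := by
      gcongr
      nlinarith
    linarith
  have h2 := geom_sum_mul_neg (Real.exp (-(2 * k * t))) M
  have h3 : 0 ≤ ∑ m ∈ Finset.range M, Real.exp (-(2 * k * t)) ^ m := by positivity
  have h4 : 0 ≤ Real.exp (-(2 * k * t)) ^ M := by positivity
  nlinarith

lemma norm_qPoch_periods_le (hζ : IsPrimitiveRoot ζ k) (hk : Odd k) (a : ℕ) {t : ℝ}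
    (ht : 0 ≤ t) (M : ℕ) :
    ‖qPoch (radial ζ t ^ a) (radial ζ t ^ 2) (k * M)‖ ≤ Real.exp (k * 2 ^ k * (a + 2 * k) *
      (t * ∑ m ∈ Finset.range M, Real.exp (-(2 * k * t)) ^ m)) := by
  induction M with
  | zero => simp [qPoch_zero]
  | succ M ih =>
    have hρ : 0 ≤ Real.exp (-(2 * k * t)) ^ M := by positivity
    have hρ1 : Real.exp (-(2 * k * t)) ^ M ≤ 1 :=
      pow_le_one₀ (by positivity) (by simpa using by positivity)
    have h := norm_qPoch_period_sub_le hζ hk a ht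
      (w := ((Real.exp (-(2 * k * t)) ^ M : ℝ) : ℂ)) (by rwa [Complex.norm_of_nonneg hρ])
    rw [Complex.norm_of_nonneg hρ] at h
    rw [mul_add_one, qPoch_add, radial_sq_pow_mul hζ, norm_mul, Finset.sum_range_succ, mul_add t,
      mul_add (_ * _), Real.exp_add, mul_comm (_ ^ a)]
    generalize Real.exp (-(2 * k * t)) ^ M = ρ at *
    gcongr
    refine le_trans ?_ (Real.add_one_le_exp _)
    have h1 : ‖(1 : ℂ) - (ρ : ℂ) ^ k‖ ≤ 1 := by
      rw [← Complex.ofReal_pow, ← Complex.ofReal_one, ← Complex.ofReal_sub, Complex.norm_real,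
        Real.norm_eq_abs, abs_le]
      constructor <;> linarith [pow_nonneg hρ k, pow_le_one₀ hρ hρ1 (n := k)]
    linarith [norm_le_norm_add_norm_sub' (qPoch (ρ * radial ζ t ^ a) (radial ζ t ^ 2) k)
      (1 - (ρ : ℂ) ^ k)]

lemma le_norm_qPoch_periods (hζ : IsPrimitiveRoot ζ k) (hk : Odd k) (a : ℕ) {t : ℝ}
    (ht : 0 ≤ t) (ht' : k * 2 ^ k * (a + 2 * k) * t ≤ 1 / 2) (M : ℕ) :
    Real.exp (-(2 * (k * 2 ^ k * (a + 2 * k) *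
      (t * ∑ m ∈ Finset.range M, Real.exp (-(2 * k * t)) ^ m)))) ≤
      ‖qPoch (-radial ζ t ^ a) (radial ζ t ^ 2) (k * M)‖ := by
  induction M with
  | zero => simp [qPoch_zero]
  | succ M ih =>
    have hρ : 0 ≤ Real.exp (-(2 * k * t)) ^ M := by positivity
    have hρ1 : Real.exp (-(2 * k * t)) ^ M ≤ 1 :=
      pow_le_one₀ (by positivity) (by simpa using by positivity)
    have h := norm_qPoch_period_sub_le hζ hk a ht
      (w := -((Real.exp (-(2 * k * t)) ^ M : ℝ) : ℂ))
      (by rwa [norm_neg, Complex.norm_of_nonneg hρ])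
    rw [norm_neg, Complex.norm_of_nonneg hρ, hk.neg_pow, sub_neg_eq_add] at h
    rw [mul_add_one k, qPoch_add, radial_sq_pow_mul hζ, norm_mul, Finset.sum_range_succ, mul_add t,
      mul_add (_ * _) (t * _), mul_add 2 (_ * _), neg_add, Real.exp_add, neg_mul_comm,
      mul_comm (_ ^ a)]
    generalize Real.exp (-(2 * k * t)) ^ M = ρ at *
    refine mul_le_mul ih ?_ (Real.exp_pos _).le (norm_nonneg _)
    have hc : (k * 2 ^ k * (a + 2 * k) : ℝ) * (t * ρ) ≤ k * 2 ^ k * (a + 2 * k) * t := by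
      gcongr
      exact mul_le_of_le_one_right ht hρ1
    refine (exp_neg_two_mul_le (by positivity) (hc.trans ht')).trans ?_
    have h1 : 1 ≤ ‖(1 : ℂ) + (ρ : ℂ) ^ k‖ := by
      rw [← Complex.ofReal_pow, ← Complex.ofReal_one, ← Complex.ofReal_add, Complex.norm_real,
        Real.norm_eq_abs]
      exact (le_add_of_nonneg_right (pow_nonneg hρ k)).trans (le_abs_self _)
    rw [mul_comm ρ t] at h
    linarith [norm_le_norm_add_norm_sub (qPoch (-ρ * radial ζ t ^ a) (radial ζ t ^ 2) k)
      (1 + (ρ : ℂ) ^ k)]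

lemma inv_le_norm_one_add_radial_pow (hζ : IsPrimitiveRoot ζ k) (hk : Odd k) {t : ℝ} (ht : 0 ≤ t)
    (m : ℕ) : (k : ℝ)⁻¹ ≤ ‖1 + radial ζ t ^ m‖ := by
  have hr := norm_radial_le (hζ.norm'_eq_one hk.pos.ne') ht
  have h1 := mul_neg_geom_sum (-radial ζ t ^ m) k
  have h2 : (1 : ℝ) ≤ ‖1 - (-radial ζ t ^ m) ^ k‖ := by
    rw [hk.neg_pow, ← pow_mul, radial_pow, mul_comm m, pow_mul, hζ.pow_eq_one, one_pow, one_mul,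
      sub_neg_eq_add, ← Complex.ofReal_one, ← Complex.ofReal_add, Complex.norm_real,
      Real.norm_eq_abs]
    exact (le_add_of_nonneg_right (Real.exp_pos _).le).trans (le_abs_self _)
  have h3 : ‖∑ i ∈ Finset.range k, (-radial ζ t ^ m) ^ i‖ ≤ k := by
    refine (norm_sum_le _ _).trans ?_
    simpa using Finset.sum_le_card_nsmul (Finset.range k) (fun i => ‖(-radial ζ t ^ m) ^ i‖) 1
      fun i _ => by
        rw [norm_pow, norm_neg, norm_pow]
        exact pow_le_one₀ (by positivity) (pow_le_one₀ (norm_nonneg _) hr)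
  rw [← h1, norm_mul, sub_neg_eq_add] at h2
  have hk0 : (0 : ℝ) < k := by exact_mod_cast hk.pos
  rw [inv_le_iff_one_le_mul₀ hk0]
  exact h2.trans (by gcongr)

lemma inv_pow_le_norm_qPoch_neg (hζ : IsPrimitiveRoot ζ k) (hk : Odd k) {t : ℝ} (ht : 0 ≤ t)
    (a n : ℕ) : ((k : ℝ)⁻¹) ^ n ≤ ‖qPoch (-radial ζ t ^ a) (radial ζ t ^ 2) n‖ := by
  rw [qPoch, norm_prod]
  refine (by simp : (k : ℝ)⁻¹ ^ n = ∏ _j ∈ Finset.range n, (k : ℝ)⁻¹).trans_le ?_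
  refine Finset.prod_le_prod (fun _ _ => by positivity) fun j _ => ?_
  have := inv_le_norm_one_add_radial_pow hζ hk ht (a + 2 * j)
  rwa [pow_add, pow_mul, ← sub_neg_eq_add, ← neg_mul] at this

lemma exists_norm_qPoch_radial_div_le (hζ : IsPrimitiveRoot ζ k) (hk : Odd k) (a b : ℕ) :
    ∃ C, 0 ≤ C ∧ ∀ᶠ t : ℝ in 𝓝[>] 0, ∀ n, ‖qPoch (radial ζ t ^ a) (radial ζ t ^ 2) n /
      qPoch (-radial ζ t ^ b) (radial ζ t ^ 2) n‖ ≤ C := by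
  set A : ℝ := k * 2 ^ k * (a + 2 * k) with hA
  set B : ℝ := k * 2 ^ k * (b + 2 * k) with hB
  have hk1 : (1 : ℝ) ≤ k := by exact_mod_cast hk.pos
  refine ⟨Real.exp A * 2 ^ k / (Real.exp (-(2 * B)) * (k : ℝ)⁻¹ ^ k), by positivity, ?_⟩
  have hsmall : ∀ᶠ t : ℝ in 𝓝[>] 0, B * t ≤ 1 / 2 := by
    have : Tendsto (fun t : ℝ => B * t) (𝓝[>] 0) (𝓝 0) := by
      simpa using (tendsto_nhdsWithin_of_tendsto_nhds (tendsto_id (α := ℝ) (x := 𝓝 0))).const_mul B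
    exact this.eventually_le_const (by norm_num)
  filter_upwards [hsmall, self_mem_nhdsWithin, Ioc_mem_nhdsGT (show (0 : ℝ) < 1 / 2 by norm_num)]
    with t htB ht0 ht1 n
  have ht : 0 ≤ t := (Set.mem_Ioi.mp ht0).le
  have hr := norm_radial_le (hζ.norm'_eq_one hk.pos.ne') ht
  have hgeom := mul_geom_sum_le hk.pos ht ht1.2 (n / k)
  have hmod : n % k ≤ k := (Nat.mod_lt n hk.pos).le
  have hra : ‖radial ζ t ^ a‖ ≤ 1 := by
    rw [norm_pow]
    exact pow_le_one₀ (norm_nonneg _) hr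
  rw [← Nat.div_add_mod n k, norm_div, qPoch_add, qPoch_add, norm_mul, norm_mul]
  have e : -radial ζ t ^ b * (radial ζ t ^ 2) ^ (k * (n / k)) =
      -radial ζ t ^ (b + 2 * (k * (n / k))) := by ring
  rw [e]
  gcongr
  · refine (norm_qPoch_periods_le hζ hk a ht _).trans (Real.exp_le_exp.mpr ?_)
    exact mul_le_of_le_one_right (by positivity) hgeom
  · refine (norm_qPoch_le (norm_mul_pow_le_one hra (norm_sq_le_one hr) _)
      (norm_sq_le_one hr) _).trans (pow_le_pow_right₀ one_le_two hmod)
  · refine le_trans (Real.exp_le_exp.mpr ?_) (le_norm_qPoch_periods hζ hk b ht htB _)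
    have := mul_le_of_le_one_right (show 0 ≤ B by positivity) hgeom
    linarith
  · refine le_trans ?_ (inv_pow_le_norm_qPoch_neg hζ hk ht _ _)
    exact pow_le_pow_of_le_one (by positivity) (inv_le_one_of_one_le₀ hk1) hmod

lemma exists_norm_heine_radial_le (hζ : IsPrimitiveRoot ζ k) (hk : Odd k) (a b : ℕ) :
    ∃ C, 0 ≤ C ∧ ∀ᶠ t : ℝ in 𝓝[>] 0, ‖heine (radial ζ t ^ a) (-radial ζ t ^ b)
      (radial ζ t ^ 2) (-radial ζ t)‖ ≤ C / t := by
  obtain ⟨C, hC0, hC⟩ := exists_norm_qPoch_radial_div_le hζ hk a b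
  refine ⟨C * 2, by positivity, ?_⟩
  filter_upwards [hC, self_mem_nhdsWithin, Ioc_mem_nhdsGT (show (0 : ℝ) < 1 by norm_num)]
    with t htC ht0 ht1
  have ht : 0 < t := ht0
  have hexp : Real.exp (-t) ≤ 1 - t / 2 := by
    have := exp_neg_two_mul_le (y := t / 2) (by positivity) (by linarith [ht1.2])
    rwa [mul_div_cancel₀ _ two_ne_zero] at this
  have hlt : Real.exp (-t) < 1 := by linarith
  have hg := (hasSum_geometric_of_lt_one (Real.exp_pos (-t)).le hlt).mul_left C
  refine (tsum_of_norm_bounded hg fun n => ?_).trans ?_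
  · rw [norm_mul, norm_pow, norm_neg, norm_radial (hζ.norm'_eq_one hk.pos.ne')]
    gcongr
    exact htC n
  · rw [mul_div_assoc, ← inv_div]
    gcongr
    linarith

end RadialBound

lemma two_mul_exp_mul_eta_div {τ : ℂ} :
    2 * Complex.exp (-(Real.pi * Complex.I * τ)) * eta (4 * τ) ^ 5 / eta (2 * τ) ^ 4 =
      2 * qPochInf (ee τ ^ 4) (ee τ ^ 4) ^ 5 / qPochInf (ee τ ^ 2) (ee τ ^ 2) ^ 4 := by
  have h4 : ee (4 * τ) = ee τ ^ 4 := by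
    rw [ee, ee, ← Complex.exp_nat_mul]
    push_cast
    ring_nf
  have h2 : ee (2 * τ) = ee τ ^ 2 := by
    rw [ee, ee, ← Complex.exp_nat_mul]
    push_cast
    ring_nf
  have he : Complex.exp (-(Real.pi * Complex.I * τ)) *
      Complex.exp (Real.pi * Complex.I * (4 * τ) / 12) ^ 5 =
        Complex.exp (Real.pi * Complex.I * (2 * τ) / 12) ^ 4 := by
    rw [← Complex.exp_nat_mul, ← Complex.exp_nat_mul, ← Complex.exp_add]
    push_cast
    ring_nf
  rw [eta, eta, h4, h2, mul_pow, mul_pow, ← he]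
  have := Complex.exp_ne_zero (-(Real.pi * Complex.I * τ))
  have := Complex.exp_ne_zero (Real.pi * Complex.I * (4 * τ) / 12)
  rw [show ∀ a b c d : ℂ, 2 * a * (b * c) / d = a * b * (2 * c) / d by intros; ring]
  exact mul_div_mul_left _ _ (by positivity)

lemma zeta_two_mul (h k : ℕ) : zeta (2 * (h : ℤ)) k = zeta h k ^ 2 := by
  rw [zeta, zeta, ee, ee, ← Complex.exp_nat_mul]
  push_cast
  ring_nf

lemma isPrimitiveRoot_zeta {h k : ℕ} (hk : k ≠ 0) (hhk : h.Coprime k) :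
    IsPrimitiveRoot (zeta h k) k := by
  simpa [zeta, ee] using Complex.isPrimitiveRoot_exp_of_coprime h k hk hhk

lemma qT_eq_radial (h k : ℕ) (t : ℝ) : qT h k t = radial (zeta h k) t := by
  rw [qT, tauT, radial, zeta, ee, ee, Complex.ofReal_exp, ← Complex.exp_add]
  congr 1
  have : (Real.pi : ℂ) ≠ 0 := by exact_mod_cast Real.pi_ne_zero
  push_cast
  field_simp
  linear_combination (t : ℂ) * Complex.I_sq

section RadialLimit

variable {ζ : ℂ} {k : ℕ}

lemma radial_zero (ζ : ℂ) : radial ζ 0 = ζ := by simp [radial]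

lemma continuous_radial (ζ : ℂ) : Continuous (radial ζ) := by
  unfold radial
  fun_prop

lemma tendsto_sum_radial (hζ : IsPrimitiveRoot ζ k) (hk : Odd k) (J : ℕ) :
    Tendsto (fun t => ∑ n ∈ Finset.range J, (radial ζ t ^ 2) ^ n *
      qPoch (radial ζ t) (radial ζ t ^ 2) n ^ 2 / qPoch (-radial ζ t ^ 2) (radial ζ t ^ 2) n)
      (𝓝[>] 0) (𝓝 (∑ n ∈ Finset.range J, (ζ ^ 2) ^ n * qPoch ζ (ζ ^ 2) n ^ 2 /
        qPoch (-ζ ^ 2) (ζ ^ 2) n)) := by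
  have hc := continuous_radial ζ
  refine tendsto_finsetSum _ fun n _ => ?_
  have hne : qPoch (-radial ζ 0 ^ 2) (radial ζ 0 ^ 2) n ≠ 0 := by
    have hk0 : (0 : ℝ) < k := by exact_mod_cast hk.pos
    exact norm_pos_iff.mp ((by positivity : 0 < (k : ℝ)⁻¹ ^ n).trans_le
      (inv_pow_le_norm_qPoch_neg hζ hk le_rfl 2 n))
  have h : ContinuousAt (fun t => (radial ζ t ^ 2) ^ n *
      qPoch (radial ζ t) (radial ζ t ^ 2) n ^ 2 / qPoch (-radial ζ t ^ 2) (radial ζ t ^ 2) n) 0 := by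
    refine ContinuousAt.div ?_ ?_ hne <;>
    · unfold qPoch
      fun_prop
  simpa only [radial_zero] using h.tendsto.mono_left nhdsWithin_le_nhds

lemma norm_qPoch_radial_le (hζ : IsPrimitiveRoot ζ k) (hk : Odd k) {t : ℝ} (ht : 0 ≤ t) :
    ‖qPoch (radial ζ t) (radial ζ t ^ 2) ((k - 1) / 2 + 1)‖ ≤ 2 ^ ((k - 1) / 2) * (k * t) := by
  have hn := hζ.norm'_eq_one hk.pos.ne'
  have hr := norm_radial_le hn ht
  rw [qPoch_succ, norm_mul]
  refine mul_le_mul (norm_qPoch_le hr (norm_sq_le_one hr) _) ?_ (norm_nonneg _) (by positivity)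
  have e : 1 - radial ζ t * (radial ζ t ^ 2) ^ ((k - 1) / 2) = -(radial ζ t ^ k - ζ ^ k) := by
    obtain ⟨m, rfl⟩ := hk
    rw [hζ.pow_eq_one, show (2 * m + 1 - 1) / 2 = m by omega]
    ring
  rw [e, norm_neg]
  exact norm_radial_pow_sub_le hn ht k

lemma tendsto_remainder_radial (hζ : IsPrimitiveRoot ζ k) (hk : Odd k) {J : ℕ}
    (hJ : J = (k - 1) / 2 + 1) :
    Tendsto (fun t => qPoch (radial ζ t) (radial ζ t ^ 2) J ^ 2 /
      qPoch (-radial ζ t ^ 2) (radial ζ t ^ 2) J *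
        ((1 + (radial ζ t ^ 2) ^ J) / (2 * (1 + radial ζ t))) *
        heine (radial ζ t ^ (2 * J + 1)) (-radial ζ t ^ 3) (radial ζ t ^ 2) (-radial ζ t))
      (𝓝[>] 0) (𝓝 0) := by
  obtain ⟨C, hC0, hC⟩ := exists_norm_heine_radial_le hζ hk (2 * J + 1) 3
  have hn := hζ.norm'_eq_one hk.pos.ne'
  have hk0 : (0 : ℝ) < k := by exact_mod_cast hk.pos
  have hlim : Tendsto (fun t : ℝ => (2 ^ ((k - 1) / 2) * k) ^ 2 / (k : ℝ)⁻¹ ^ J *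
      (2 / (2 * (k : ℝ)⁻¹)) * C * t) (𝓝[>] 0) (𝓝 0) := by
    generalize (2 ^ ((k - 1) / 2) * k) ^ 2 / (k : ℝ)⁻¹ ^ J * (2 / (2 * (k : ℝ)⁻¹)) * C = c
    simpa using (tendsto_nhdsWithin_of_tendsto_nhds (tendsto_id (α := ℝ) (x := 𝓝 0))).const_mul c
  refine squeeze_zero_norm' ?_ hlim
  filter_upwards [hC, self_mem_nhdsWithin] with t htC ht0
  have ht : 0 < t := ht0
  have hr := norm_radial_le hn ht.le
  have h1 : ‖qPoch (radial ζ t) (radial ζ t ^ 2) J‖ ≤ 2 ^ ((k - 1) / 2) * (k * t) := by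
    rw [hJ]
    exact norm_qPoch_radial_le hζ hk ht.le
  have h2 := inv_pow_le_norm_qPoch_neg hζ hk ht.le 2 J
  have h3 : (k : ℝ)⁻¹ ≤ ‖1 + radial ζ t‖ := by
    simpa using inv_le_norm_one_add_radial_pow hζ hk ht.le 1
  have h4 : ‖1 + (radial ζ t ^ 2) ^ J‖ ≤ 2 := by
    rw [← sub_neg_eq_add]
    refine norm_one_sub_le_two ?_
    rw [norm_neg, norm_pow]
    exact pow_le_one₀ (norm_nonneg _) (norm_sq_le_one hr)
  rw [norm_mul, norm_mul, norm_div, norm_div, norm_pow, norm_mul, Complex.norm_ofNat]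
  calc _ ≤ (2 ^ ((k - 1) / 2) * (k * t)) ^ 2 / (k : ℝ)⁻¹ ^ J * (2 / (2 * (k : ℝ)⁻¹)) *
        (C / t) := by gcongr
    _ = _ := by field_simp

/-- The radial limit of `mockB (-q)` as `q` tends to a primitive root of unity of odd order. -/
lemma tendsto_mockB_neg_radial (hζ : IsPrimitiveRoot ζ k) (hk : Odd k) :
    Tendsto (fun t => mockB (-radial ζ t)) (𝓝[>] 0)
      (𝓝 (1 / 2 * ∑ n ∈ Finset.range ((k - 1) / 2 + 1), (ζ ^ 2) ^ n * qPoch ζ (ζ ^ 2) n ^ 2 /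
        qPoch (-ζ ^ 2) (ζ ^ 2) n)) := by
  have h := ((tendsto_sum_radial hζ hk ((k - 1) / 2 + 1)).const_mul (1 / 2)).add
    (tendsto_remainder_radial hζ hk rfl)
  rw [add_zero] at h
  refine h.congr' ?_
  filter_upwards [self_mem_nhdsWithin] with t ht
  have ht : 0 < t := ht
  refine (mockB_neg_eq_sum_add ?_ ?_ _).symm
  · rw [norm_radial (hζ.norm'_eq_one hk.pos.ne')]
    simpa using ht
  · exact mul_ne_zero (hζ.ne_zero hk.pos.ne') (by simp [Complex.exp_ne_zero])

end RadialLimit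

/-- Lemma 6.1 (i): radial limit of the second order mock theta function B at odd order cusps. -/
theorem statement14 (h k : ℕ) (hk : 1 ≤ k) (hodd : Odd k) (hhk : h < k)
    (hghk : Nat.gcd h k = 1) :
    Filter.Tendsto
      (fun t : ℝ =>
        mockB (qT h k t) -
          2 * Complex.exp (-(Real.pi * Complex.I * tauT h k t)) *
            eta (4 * tauT h k t) ^ 5 / eta (2 * tauT h k t) ^ 4)
      (𝓝[>] (0 : ℝ))
      (𝓝 (-(1 / 2) * ∑ n ∈ Finset.range ((k - 1) / 2 + 1),
        (zeta (2 * (h : ℤ)) k) ^ n * qPoch (zeta h k) (zeta (2 * (h : ℤ)) k) n ^ 2 /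
          qPoch (-(zeta (2 * (h : ℤ)) k)) (zeta (2 * (h : ℤ)) k) n)) := by

  have hζ := isPrimitiveRoot_zeta (by omega) hghk
  have hlim := (tendsto_mockB_neg_radial hζ hodd).neg
  simp only [zeta_two_mul, neg_mul]
  rw [← neg_mul] at hlim ⊢
  refine hlim.congr' ?_
  filter_upwards [self_mem_nhdsWithin] with t ht
  have ht : 0 < t := ht
  have hq : ‖qT h k t‖ < 1 := by
    rw [qT_eq_radial, norm_radial (hζ.norm'_eq_one (by omega))]
    simpa using ht
  rw [two_mul_exp_mul_eta_div, ← qT_eq_radial, ← qT, ← mockB_add_mockB_neg hq]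
  ring

end
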